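/- For every finite connected simple port-labeled graph G with n vertices, every root vertex v_R, and every integer k with 1 ≤ k ≤ n, the graph T whose vertex set is V' (the k vertices visited by the k-stopped port-DFS traversal) and whose edge set consists of the edges {v, u(v)} for v ∈ V' ∖ {v_R}, where u(v) is the neighbor of v reached from v through port par(v), is a spanning tree of the induced subgraph G[V']. -/

import Mathlib

open scoped Classical

/-- Direction of a move of the port-DFS traversal. -/
inductive PDir : Type where
  | fwd : PDir
  | bwd : PDir
deriving DecidableEq

/-- Position of the port-DFS walk: before the first move (`start`, at the root),
having just arrived at `cur` via in-port `inPort` with direction `dir` (`moving`),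
or halted at a vertex. -/
inductive PPos (V : Type) : Type where
  | start : PPos V
  | moving : V → ℕ → PDir → PPos V
  | halted : V → PPos V

/-- Full state of the port-DFS traversal: position, set `S` of visited vertices,
and parent-port assignment `par`. -/
structure PState (V : Type) : Type where
  pos : PPos V
  vis : Finset V
  par : V → ℕ

/-- A finite connected simple port-labeled graph: for every vertex `u` of degree
`deg u`, the edges incident to `u` are labeled by distinct ports `0, …, deg u - 1`;
`port u v` is the port at `u` of the edge `{u, v}`. -/
structure PortedGraph (V : Type) [Fintype V] [DecidableEq V] : Type where
  G : SimpleGraph V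
  conn : G.Connected
  deg : V → ℕ
  port : V → V → ℕ
  port_lt : ∀ {u v : V}, G.Adj u v → port u v < deg u
  port_inj : ∀ {u v w : V}, G.Adj u v → G.Adj u w → port u v = port u w → v = w
  port_surj : ∀ {u : V} (p : ℕ), p < deg u → ∃ v : V, G.Adj u v ∧ port u v = p

namespace PortedGraph

variable {V : Type} [Fintype V] [DecidableEq V]

/-- The neighbor of `u` reached from `u` through port `p`. -/
noncomputable def dest (P : PortedGraph V) (u : V) (p : ℕ) : V :=
  if h : ∃ v : V, P.G.Adj u v ∧ P.port u v = p then h.choose else u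

/-- One step of the port-DFS traversal from root `vR`.  A state with
`pos = moving v q d` means the walk has just arrived at `v` via port `q` (at `v`)
with direction `d`, and `vis`/`par` are the data from before processing this
arrival; the step processes the arrival according to rules (i)–(v) and performs
the next move (or halts). -/
noncomputable def step (P : PortedGraph V) (vR : V) (s : PState V) : PState V :=
  match s.pos with
  | PPos.start =>
      if 0 < P.deg vR then
        { pos := PPos.moving (P.dest vR 0) (P.port (P.dest vR 0) vR) PDir.fwd,
          vis := s.vis, par := s.par }
      else
        { pos := PPos.halted vR, vis := s.vis, par := s.par }
  | PPos.halted v => { pos := PPos.halted v, vis := s.vis, par := s.par }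
  | PPos.moving v q PDir.fwd =>
      if v ∈ s.vis then
        -- rule (ii): leave via `q` with direction backward
        { pos := PPos.moving (P.dest v q) (P.port (P.dest v q) v) PDir.bwd,
          vis := s.vis, par := s.par }
      else
        -- rule (i): add `v` to `S`, set `par v := q`, leave via `(q+1) % deg v`
        { pos := PPos.moving (P.dest v ((q + 1) % P.deg v))
            (P.port (P.dest v ((q + 1) % P.deg v)) v)
            (if (q + 1) % P.deg v = q then PDir.bwd else PDir.fwd),
          vis := insert v s.vis, par := Function.update s.par v q }
  | PPos.moving v q PDir.bwd =>
      if v ≠ vR ∧ (q + 1) % P.deg v = s.par v then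
        -- rule (iii): leave via the parent port with direction backward
        { pos := PPos.moving (P.dest v (s.par v)) (P.port (P.dest v (s.par v)) v) PDir.bwd,
          vis := s.vis, par := s.par }
      else if v = vR ∧ (q + 1) % P.deg v = 0 then
        -- rule (iv): halt
        { pos := PPos.halted v, vis := s.vis, par := s.par }
      else
        -- rule (v): leave via `(q+1) % deg v` with direction forward
        { pos := PPos.moving (P.dest v ((q + 1) % P.deg v))
            (P.port (P.dest v ((q + 1) % P.deg v)) v) PDir.fwd,
          vis := s.vis, par := s.par }

/-- The trace of the port-DFS traversal from `vR`:  `trace P vR t` is the state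
after `t` transitions; every transition except those into/out of a halted
position is a move along an edge. -/
noncomputable def trace (P : PortedGraph V) (vR : V) : ℕ → PState V
  | 0 => { pos := PPos.start, vis := {vR}, par := fun _ => 0 }
  | t + 1 => P.step vR (P.trace vR t)

/-- The first time at which `k` distinct vertices have been visited; the
`k`-stopped traversal is the traversal halted at that moment (at which point the
walk, having made `stopTime - 1` moves, stands at the `k`-th visited vertex). -/
noncomputable def stopTime (P : PortedGraph V) (vR : V) (k : ℕ) : ℕ :=
  sInf {t : ℕ | k ≤ ((P.trace vR t).vis).card}

/-- `V'`: the set of vertices visited by the `k`-stopped traversal. -/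
noncomputable def visitedBy (P : PortedGraph V) (vR : V) (k : ℕ) : Finset V :=
  (P.trace vR (P.stopTime vR k)).vis

/-- `V'` as a set. -/
noncomputable def Vset (P : PortedGraph V) (vR : V) (k : ℕ) : Set V :=
  ↑(P.visitedBy vR k)

/-- The parent-port assignment at the end of the `k`-stopped traversal. -/
noncomputable def parFinal (P : PortedGraph V) (vR : V) (k : ℕ) : V → ℕ :=
  (P.trace vR (P.stopTime vR k)).par

/-- `u(v)`: the neighbor of `v` reached from `v` through its parent port. -/
noncomputable def parentVert (P : PortedGraph V) (vR : V) (k : ℕ) (v : V) : V :=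
  P.dest v (P.parFinal vR k v)

/-- `v_L`: the `k`-th (last) vertex added to `S` by the `k`-stopped traversal. -/
noncomputable def lastVert (P : PortedGraph V) (vR : V) (k : ℕ) : V :=
  if h : ∃ v : V, v ∈ P.visitedBy vR k ∧ v ∉ (P.trace vR (P.stopTime vR k - 1)).vis
  then h.choose else vR

/-- The tree `T` of parent edges `{v, u(v)}`, `v ∈ V' \ {v_R}`, as a graph on `V`
(vertices outside `V'` are isolated). -/
noncomputable def treeRel (P : PortedGraph V) (vR : V) (k : ℕ) : SimpleGraph V :=
  SimpleGraph.fromRel (fun a b =>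
    a ∈ P.visitedBy vR k ∧ a ≠ vR ∧ b = P.parentVert vR k a)

/-- The tree `T` of parent edges as a graph on the vertex set `V'`. -/
noncomputable def treeSub (P : PortedGraph V) (vR : V) (k : ℕ) :
    SimpleGraph (P.Vset vR k) :=
  SimpleGraph.fromRel (fun a b => (a : V) ≠ vR ∧ (b : V) = P.parentVert vR k (a : V))

/-- `v` lies on the rootpath: the unique path in `T` from `v_R` to `v_L`. -/
def onRootpath (P : PortedGraph V) (vR : V) (k : ℕ) (v : V) : Prop :=
  ∃ p : (P.treeRel vR k).Walk vR (P.lastVert vR k), p.IsPath ∧ v ∈ p.support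

/-- The move made out of state `s`:  `some (v, p, d)` if the walk leaves vertex
`v` via port `p` with direction `d`, and `none` if it halts (or already halted). -/
noncomputable def exitEvent (P : PortedGraph V) (vR : V) (s : PState V) :
    Option (V × ℕ × PDir) :=
  match s.pos with
  | PPos.start => if 0 < P.deg vR then some (vR, 0, PDir.fwd) else none
  | PPos.halted _ => none
  | PPos.moving v q PDir.fwd =>
      if v ∈ s.vis then some (v, q, PDir.bwd)
      else some (v, (q + 1) % P.deg v,
        if (q + 1) % P.deg v = q then PDir.bwd else PDir.fwd)
  | PPos.moving v q PDir.bwd =>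
      if v ≠ vR ∧ (q + 1) % P.deg v = s.par v then some (v, s.par v, PDir.bwd)
      else if v = vR ∧ (q + 1) % P.deg v = 0 then none
      else some (v, (q + 1) % P.deg v, PDir.fwd)

end PortedGraph

/-- A parent map that strictly decreases a rank on every non-root vertex spans a tree. -/
theorem SimpleGraph.isTree_fromRel_parent {W : Type*} [Finite W] (root : W) (f : W → W)
    (rank : W → ℕ) (hrank : ∀ w, w ≠ root → rank (f w) < rank w) :
    (SimpleGraph.fromRel fun a b => a ≠ root ∧ b = f a).IsTree := by
  set T : SimpleGraph W := SimpleGraph.fromRel fun a b => a ≠ root ∧ b = f a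
  have hadj : ∀ w, w ≠ root → T.Adj w (f w) := by
    intro w hw
    refine (SimpleGraph.fromRel_adj _ _ _).2 ⟨fun h => ?_, Or.inl ⟨hw, rfl⟩⟩
    have := hrank w hw
    rw [← h] at this
    exact lt_irrefl _ this
  have hreach : ∀ n w, rank w = n → T.Reachable w root := by
    intro n
    induction n using Nat.strong_induction_on with
    | _ n ih =>
      intro w hw
      by_cases h : w = root
      · exact h ▸ SimpleGraph.Reachable.refl _
      · exact (hadj w h).reachable.trans (ih _ (hw ▸ hrank w h) _ rfl)
  have hconn : T.Connected :=
    (SimpleGraph.connected_iff_exists_forall_reachable T).2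
      ⟨root, fun w => (hreach _ w rfl).symm⟩
  refine SimpleGraph.isTree_iff_connected_and_card.2
    ⟨hconn, le_antisymm ?_ hconn.card_vert_le_card_edgeSet_add_one⟩
  let g : {w : W // w ≠ root} → T.edgeSet := fun w => ⟨s(w.1, f w.1), hadj w.1 w.2⟩
  have hg : Function.Surjective g := by
    rintro ⟨e, he⟩
    induction e with
    | _ a b =>
      obtain ⟨-, ⟨ha, rfl⟩ | ⟨hb, rfl⟩⟩ := (SimpleGraph.fromRel_adj _ _ _).1 (show T.Adj a b from he)
      · exact ⟨⟨a, ha⟩, rfl⟩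
      · exact ⟨⟨b, hb⟩, Subtype.ext Sym2.eq_swap⟩
  have hcard : Nat.card {w : W // w ≠ root} < Nat.card W :=
    Finite.card_subtype_lt (x := root) (by simp)
  exact (Nat.card_le_card_of_surjective g hg).trans_lt hcard

namespace PortedGraph

variable {V : Type} [Fintype V] [DecidableEq V]

theorem adj_dest_and_port (P : PortedGraph V) {u : V} {p : ℕ} (hp : p < P.deg u) :
    P.G.Adj u (P.dest u p) ∧ P.port u (P.dest u p) = p := by
  have h := P.port_surj p hp
  rw [dest, dif_pos h]
  exact h.choose_spec

theorem dest_port (P : PortedGraph V) {u v : V} (h : P.G.Adj u v) :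
    P.dest u (P.port u v) = v := by
  obtain ⟨h₁, h₂⟩ := P.adj_dest_and_port (P.port_lt h)
  exact P.port_inj h₁ h h₂

/-- The parent edges of the visited vertices are edges of `G`, stay among the visited vertices,
and lead to the root. -/
structure ParentInv (P : PortedGraph V) (vR : V) (vis : Finset V) (par : V → ℕ) : Prop where
  root_mem : vR ∈ vis
  par_lt : ∀ v ∈ vis, v ≠ vR → par v < P.deg v
  parent_mem : ∀ v ∈ vis, v ≠ vR → P.dest v (par v) ∈ vis
  exists_rank : ∃ rank : V → ℕ, ∀ v ∈ vis, v ≠ vR → rank (P.dest v (par v)) < rank v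

/-- The walk has just arrived along an edge from a visited vertex, and it only moves backward
into visited vertices. -/
def PosInv (P : PortedGraph V) (vis : Finset V) : PPos V → Prop
  | PPos.start => True
  | PPos.halted _ => True
  | PPos.moving v q d =>
      q < P.deg v ∧ P.dest v q ∈ vis ∧ (d = PDir.bwd → v ∈ vis)

theorem ParentInv.insert {P : PortedGraph V} {vR : V} {vis : Finset V} {par : V → ℕ}
    (h : P.ParentInv vR vis par) {v : V} {q : ℕ} (hv : v ∉ vis) (hq : q < P.deg v)
    (hmem : P.dest v q ∈ vis) :
    P.ParentInv vR (insert v vis) (Function.update par v q) := by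
  have hne : ∀ x ∈ vis, x ≠ v := fun x hx hxv => hv (hxv ▸ hx)
  refine ⟨Finset.mem_insert_of_mem h.root_mem, ?_, ?_, ?_⟩
  · intro x hx hxR
    obtain rfl | hx := Finset.mem_insert.1 hx
    · simpa using hq
    · simpa [hne x hx] using h.par_lt x hx hxR
  · intro x hx hxR
    obtain rfl | hx := Finset.mem_insert.1 hx
    · simp [hmem]
    · simp [hne x hx, h.parent_mem x hx hxR]
  · obtain ⟨rank, hrank⟩ := h.exists_rank
    refine ⟨Function.update rank v (rank (P.dest v q) + 1), fun x hx hxR => ?_⟩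
    obtain rfl | hx := Finset.mem_insert.1 hx
    · simp [hne _ hmem]
    · simpa [hne x hx, hne _ (h.parent_mem x hx hxR)] using hrank x hx hxR

/-- Leaving a visited vertex `v` through a valid port establishes the position invariant. -/
theorem posInv_leave (P : PortedGraph V) {vis : Finset V} {v : V} {p : ℕ} {d : PDir}
    (hv : v ∈ vis) (hp : p < P.deg v) (hd : d = PDir.bwd → P.dest v p ∈ vis) :
    P.PosInv vis (PPos.moving (P.dest v p) (P.port (P.dest v p) v) d) := by
  have hadj := (P.adj_dest_and_port hp).1.symm
  exact ⟨P.port_lt hadj, by rwa [P.dest_port hadj], hd⟩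

theorem step_inv (P : PortedGraph V) (vR : V) (s : PState V)
    (hpar : P.ParentInv vR s.vis s.par) (hpos : P.PosInv s.vis s.pos) :
    P.ParentInv vR (P.step vR s).vis (P.step vR s).par ∧
      P.PosInv (P.step vR s).vis (P.step vR s).pos := by
  obtain ⟨pos, vis, par⟩ := s
  dsimp only at hpar hpos
  match pos with
  | PPos.start =>
    simp only [step]
    split_ifs with h
    · exact ⟨hpar, P.posInv_leave hpar.root_mem h (by simp)⟩
    · exact ⟨hpar, trivial⟩
  | PPos.halted v => exact ⟨hpar, trivial⟩
  | PPos.moving v q PDir.fwd =>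
    obtain ⟨hq, hmem, -⟩ := hpos
    simp only [step]
    split_ifs with hv hback
    · exact ⟨hpar, P.posInv_leave hv hq fun _ => hmem⟩
    all_goals
      refine ⟨hpar.insert hv hq hmem, P.posInv_leave (Finset.mem_insert_self v vis)
        (Nat.mod_lt _ (Nat.zero_lt_of_lt hq)) fun hd => ?_⟩
    · rw [hback]
      exact Finset.mem_insert_of_mem hmem
    · cases hd
  | PPos.moving v q PDir.bwd =>
    obtain ⟨hq, -, hv⟩ := hpos
    have hv := hv rfl
    simp only [step]
    split_ifs with hparent hhalt
    · exact ⟨hpar, P.posInv_leave hv (hpar.par_lt v hv hparent.1) fun _ =>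
        hpar.parent_mem v hv hparent.1⟩
    · exact ⟨hpar, trivial⟩
    · exact ⟨hpar, P.posInv_leave hv (Nat.mod_lt _ (Nat.zero_lt_of_lt hq)) (by simp)⟩

theorem trace_inv (P : PortedGraph V) (vR : V) (t : ℕ) :
    P.ParentInv vR (P.trace vR t).vis (P.trace vR t).par ∧
      P.PosInv (P.trace vR t).vis (P.trace vR t).pos := by
  induction t with
  | zero =>
    refine ⟨⟨?_, ?_, ?_, 0, ?_⟩, trivial⟩ <;> simp +contextual [trace]
  | succ t ih => exact P.step_inv vR _ ih.1 ih.2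

end PortedGraph

/-- For every finite connected simple port-labeled graph `G` with `n`
vertices, every root vertex `v_R`, and every `1 ≤ k ≤ n`, the graph `T` on vertex
set `V'` whose edges are `{v, u(v)}` for `v ∈ V' \ {v_R}` (where `u(v)` is the
neighbor of `v` reached through its parent port) is a spanning tree of the
induced subgraph `G[V']`: it is a tree on the full vertex set `V'` and a subgraph
of `G[V']`. -/
theorem statement2 {V : Type} [Fintype V] [DecidableEq V]
    (P : PortedGraph V) (vR : V) (k : ℕ)
    (hk1 : 1 ≤ k) (hk2 : k ≤ Fintype.card V) :
    (P.treeSub vR k).IsTree ∧ P.treeSub vR k ≤ P.G.induce (P.Vset vR k) := by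
  have hinv : P.ParentInv vR (P.visitedBy vR k) (P.parFinal vR k) :=
    (P.trace_inv vR (P.stopTime vR k)).1
  constructor
  · obtain ⟨rank, hrank⟩ := hinv.exists_rank
    let root : P.Vset vR k := ⟨vR, hinv.root_mem⟩
    let f : P.Vset vR k → P.Vset vR k := fun w =>
      if h : (w : V) ≠ vR then ⟨P.parentVert vR k w, hinv.parent_mem w w.2 h⟩ else w
    have hf : ∀ w : P.Vset vR k, (w : V) ≠ vR → (f w : V) = P.parentVert vR k w := fun w h => by
      simp only [f, dif_pos h]
    have hroot : ∀ w : P.Vset vR k, w ≠ root ↔ (w : V) ≠ vR := fun w =>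
      Subtype.ext_iff.not
    have htree := SimpleGraph.isTree_fromRel_parent root f (fun w => rank w) fun w hw => by
      have hw := (hroot w).1 hw
      rw [hf w hw]
      exact hrank w w.2 hw
    convert htree using 1
    unfold PortedGraph.treeSub
    congr 1
    ext a b
    rw [hroot, and_congr_right_iff]
    intro ha
    rw [Subtype.ext_iff, hf a ha]
  · have hadj : ∀ a b : P.Vset vR k, (a : V) ≠ vR → (b : V) = P.parentVert vR k a →
        P.G.Adj a b := fun a b ha hb => by
      rw [hb]
      exact (P.adj_dest_and_port (hinv.par_lt a a.2 ha)).1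
    intro a b hab
    obtain ⟨-, ⟨ha, hb⟩ | ⟨hb, ha⟩⟩ := (SimpleGraph.fromRel_adj _ _ _).1 hab
    · exact hadj a b ha hb
    · exact (hadj b a hb ha).symm
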